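/- Let Ω ⊆ ℝⁿ be open, and for each triple of indices i,j,l ∈ {1,…,n} let Γ^l_{ij} : Ω → ℝ be continuously differentiable. Define R^i_{kln} := ∂Γ^i_{nk}/∂x^l − ∂Γ^i_{lk}/∂x^n + Σ_m (Γ^i_{lm}Γ^m_{nk} − Γ^i_{nm}Γ^m_{lk}). Suppose there exist n functions y¹,…,yⁿ : Ω → ℝ, each three times continuously differentiable, each satisfying the Lame system ∂²y^k/∂x^i∂x^j = Σ_l Γ^l_{ij}·∂y^k/∂x^l on Ω, and such that at every point of Ω the Jacobian matrix (∂y^k/∂x^l)_{k,l} is invertible. Then R^i_{kln} = 0 identically on Ω for all indices i,k,l,n. -/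

import Mathlib

/-- Partial derivative of `f : ℝⁿ → ℝ` in the `i`-th coordinate direction. -/
noncomputable def pd {n : ℕ} (i : Fin n) (f : (Fin n → ℝ) → ℝ) (p : Fin n → ℝ) : ℝ :=
  fderiv ℝ f p (Pi.single i 1)

theorem pd_contDiffOn {n : ℕ} {Ω : Set (Fin n → ℝ)} (hΩ : IsOpen Ω) {f : (Fin n → ℝ) → ℝ}
    {a b : WithTop ℕ∞} (hf : ContDiffOn ℝ b f Ω) (hab : a + 1 ≤ b) (i : Fin n) :
    ContDiffOn ℝ a (pd i f) Ω := by
  have h := hf.fderiv_of_isOpen hΩ hab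
  exact h.clm_apply contDiffOn_const

theorem pd_comm {n : ℕ} {f : (Fin n → ℝ) → ℝ} {p : Fin n → ℝ}
    (hf : ContDiffAt ℝ 2 f p) (l m : Fin n) :
    pd l (pd m f) p = pd m (pd l f) p := by
  have hd : DifferentiableAt ℝ (fderiv ℝ f) p :=
    (hf.fderiv_right (m := 1) (by norm_num)).differentiableAt (by norm_num)
  have key : ∀ u v : Fin n → ℝ,
      fderiv ℝ (fun q => fderiv ℝ f q v) p u = fderiv ℝ (fderiv ℝ f) p u v := by
    intro u v
    rw [fderiv_clm_apply hd (differentiableAt_const v)]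
    simp
  have hs : IsSymmSndFDerivAt ℝ f p := hf.isSymmSndFDerivAt (by simp)
  have := hs (Pi.single l 1) (Pi.single m 1)
  rw [← key, ← key] at this
  exact this

theorem pd_lame {n : ℕ} {Ω : Set (Fin n → ℝ)} (hΩ : IsOpen Ω)
    (Γ : Fin n → Fin n → Fin n → (Fin n → ℝ) → ℝ)
    (hΓ : ∀ l i j, ContDiffOn ℝ 1 (Γ l i j) Ω)
    (y : (Fin n → ℝ) → ℝ) (hy : ContDiffOn ℝ 3 y Ω)
    (hL : ∀ p ∈ Ω, ∀ i j : Fin n, pd i (pd j y) p = ∑ l, Γ l i j p * pd l y p)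
    {p : Fin n → ℝ} (hp : p ∈ Ω) (k l m : Fin n) :
    pd l (pd m (pd k y)) p
      = ∑ i, (pd l (Γ i m k) p + ∑ j, Γ i l j p * Γ j m k p) * pd i y p := by
  have hn := hΩ.mem_nhds hp
  have hev : pd m (pd k y) =ᶠ[nhds p] fun q => ∑ i, Γ i m k q * pd i y q := by
    filter_upwards [hn] with q hq using hL q hq m k
  have hG : ∀ i, DifferentiableAt ℝ (Γ i m k) p := fun i =>
    ((hΓ i m k).contDiffAt hn).differentiableAt (by norm_num)
  have hY : ∀ i, DifferentiableAt ℝ (pd i y) p := fun i =>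
    ((pd_contDiffOn (a := 2) hΩ hy (by norm_num) i).contDiffAt hn).differentiableAt (by norm_num)
  have h1 : pd l (pd m (pd k y)) p
      = ∑ i, (Γ i m k p * pd l (pd i y) p + pd i y p * pd l (Γ i m k) p) := by
    have := (HasFDerivAt.fun_sum (u := Finset.univ) fun i _ =>
      (hG i).hasFDerivAt.mul (hY i).hasFDerivAt)
    have h2 := this.fderiv
    rw [pd, hev.fderiv_eq]
    refine (congrArg (fun L => L (Pi.single l 1)) h2).trans ?_
    simp [pd]
  rw [h1]
  simp only [hL p hp, add_mul, Finset.sum_add_distrib, Finset.mul_sum, Finset.sum_mul]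
  rw [add_comm]
  congr 1
  · exact Finset.sum_congr rfl fun i _ => mul_comm _ _
  · rw [Finset.sum_comm]
    exact Finset.sum_congr rfl fun i _ => Finset.sum_congr rfl fun j _ => by ring

/-- If the Lame system `∂²y^k/∂xⁱ∂xʲ = Σ_l Γ^l_{ij} ∂y^k/∂x^l` admits `n` `C³` solutions
`y¹, …, yⁿ` whose Jacobian matrix is everywhere invertible on the open set `Ω`, then the
curvature tensor of the connection `Γ` vanishes identically on `Ω`.  Here `Γ l i j` denotes
`Γ^l_{ij}` and the curvature is
`R^i_{klm} = ∂Γ^i_{mk}/∂x^l − ∂Γ^i_{lk}/∂x^m + Σ_j (Γ^i_{lj}Γ^j_{mk} − Γ^i_{mj}Γ^j_{lk})`. -/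
theorem flat_coordinates_imply_zero_curvature
    (n : ℕ) (Ω : Set (Fin n → ℝ)) (hΩ : IsOpen Ω)
    (Γ : Fin n → Fin n → Fin n → (Fin n → ℝ) → ℝ)
    (hΓ : ∀ l i j, ContDiffOn ℝ 1 (Γ l i j) Ω)
    (y : Fin n → (Fin n → ℝ) → ℝ) (hy : ∀ k, ContDiffOn ℝ 3 (y k) Ω)
    (hLame : ∀ k, ∀ p ∈ Ω, ∀ i j : Fin n,
      pd i (pd j (y k)) p = ∑ l, Γ l i j p * pd l (y k) p)
    (hJac : ∀ p ∈ Ω, IsUnit (Matrix.of fun k l : Fin n => pd l (y k) p)) :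
    ∀ p ∈ Ω, ∀ i k l m : Fin n,
      pd l (Γ i m k) p - pd m (Γ i l k) p
        + ∑ j, (Γ i l j p * Γ j m k p - Γ i m j p * Γ j l k p) = 0 := by
  intro p hp i k l m
  have hz : (Matrix.of fun a b : Fin n => pd b (y a) p).mulVec (fun i =>
      pd l (Γ i m k) p - pd m (Γ i l k) p
        + ∑ j, (Γ i l j p * Γ j m k p - Γ i m j p * Γ j l k p)) = 0 := by
    funext a
    have hc := pd_comm (((pd_contDiffOn (a := 2) hΩ (hy a) (by norm_num) k).contDiffAt
      (hΩ.mem_nhds hp))) l m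
    rw [pd_lame hΩ Γ hΓ (y a) (hy a) (hLame a) hp, pd_lame hΩ Γ hΓ (y a) (hy a) (hLame a) hp,
      ← sub_eq_zero, ← Finset.sum_sub_distrib] at hc
    rw [← show _ = (0 : Fin n → ℝ) a from hc]
    simp only [Matrix.mulVec, dotProduct, Matrix.of_apply]
    refine Finset.sum_congr rfl fun i _ => ?_
    rw [Finset.sum_sub_distrib]
    ring
  have hinj := Matrix.mulVec_injective_of_isUnit (hJac p hp)
  exact congrFun (hinj (hz.trans (Matrix.mulVec_zero _).symm)) i
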